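/- Define I₀(x) = ∑_{k=0}^∞ (x²/4)^k/(k!)² and Q₁(a,b) = ∫_{x ∈ [b,∞)} x·exp(−(x² + a²)/2)·I₀(a·x) dx. Fix N > 0 and b > 0. Then the difference between the large-N ROC expression for the detector ρ̂ and its first-order-in-ρ approximation is O(ρ²) as ρ → 0 within (−1,1): the function ρ ↦ Q₁(ρ·√(2N)/(1 − ρ²), b/(1 − ρ²)) − Q₁(ρ·√(2N), b) is big-O of ρ ↦ ρ² along the filter of neighborhoods of 0 within the open interval (−1, 1). -/

import Mathlib

open Real Filter Asymptotics

/-- The power series of the modified Bessel function of order zero converges. -/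
theorem summable_besselI_zero (x : ℝ) :
    Summable fun k : ℕ => (x ^ 2 / 4) ^ k / (Nat.factorial k : ℝ) ^ 2 := by
  refine Summable.of_nonneg_of_le (fun k => by positivity) (fun k => ?_)
    (Real.summable_pow_div_factorial (x ^ 2 / 4))
  have h : (1 : ℝ) ≤ (Nat.factorial k : ℝ) := by exact_mod_cast k.factorial_pos
  gcongr
  nlinarith

theorem one_le_besselI_zero (x : ℝ) :
    1 ≤ ∑' k : ℕ, (x ^ 2 / 4) ^ k / (Nat.factorial k : ℝ) ^ 2 := by
  simpa using (summable_besselI_zero x).le_tsum 0 (fun k _ => by positivity)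

theorem besselI_zero_le_exp (x : ℝ) :
    ∑' k : ℕ, (x ^ 2 / 4) ^ k / (Nat.factorial k : ℝ) ^ 2 ≤ Real.exp (x ^ 2 / 4) := by
  rw [Real.exp_eq_exp_ℝ, NormedSpace.exp_eq_tsum_div]
  refine (summable_besselI_zero x).tsum_le_tsum (fun k => ?_)
    (Real.summable_pow_div_factorial (x ^ 2 / 4))
  have h : (1 : ℝ) ≤ (Nat.factorial k : ℝ) := by exact_mod_cast k.factorial_pos
  gcongr
  nlinarith

theorem measurable_besselI_zero :
    Measurable fun x : ℝ => ∑' k : ℕ, (x ^ 2 / 4) ^ k / (Nat.factorial k : ℝ) ^ 2 := by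
  refine measurable_of_tendsto_metrizable
    (f := fun n x => ∑ k ∈ Finset.range n, (x ^ 2 / 4) ^ k / (Nat.factorial k : ℝ) ^ 2)
    (fun n => by fun_prop) ?_
  rw [tendsto_pi_nhds]
  exact fun x => (summable_besselI_zero x).hasSum.tendsto_sum_nat

theorem exp_sub_one_le_mul_exp (t : ℝ) : Real.exp t - 1 ≤ t * Real.exp t := by
  have h := Real.add_one_le_exp (-t)
  have h2 : Real.exp (-t) * Real.exp t = 1 := by rw [← Real.exp_add]; simp
  nlinarith [Real.exp_pos t]

theorem integrable_pow_mul_exp_neg_mul_sq (n : ℕ) {c : ℝ} (hc : 0 < c) :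
    MeasureTheory.Integrable fun x : ℝ => x ^ n * Real.exp (-c * x ^ 2) := by
  simpa using integrable_rpow_mul_exp_neg_mul_sq hc (s := n)
    (by linarith [(Nat.cast_nonneg n : (0 : ℝ) ≤ n)])

/-- The Rayleigh tail integral. -/
theorem integral_Ici_mul_exp_neg_sq_div_two (b : ℝ) :
    ∫ x in Set.Ici b, x * Real.exp (-x ^ 2 / 2) = Real.exp (-b ^ 2 / 2) := by
  have hint : MeasureTheory.Integrable fun x : ℝ => x * Real.exp (-x ^ 2 / 2) := by
    refine (integrable_pow_mul_exp_neg_mul_sq 1 (c := 1 / 2) (by norm_num)).congr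
      (.of_forall fun x => ?_)
    ring_nf
  have hlim : Tendsto (fun x : ℝ => -Real.exp (-x ^ 2 / 2)) atTop (nhds 0) := by
    have h : Tendsto (fun x : ℝ => x ^ 2 / 2) atTop atTop :=
      (tendsto_pow_atTop two_ne_zero).atTop_div_const (by norm_num)
    simpa [neg_div] using (Real.tendsto_exp_neg_atTop_nhds_zero.comp h).neg
  rw [MeasureTheory.integral_Ici_eq_integral_Ioi,
    MeasureTheory.integral_Ioi_of_hasDerivAt_of_tendsto' (fun x _ => ?_) hint.integrableOn hlim]
  · ring
  · have h := (((hasDerivAt_pow 2 x).fun_neg.div_const 2).exp).fun_neg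
    convert h using 1
    push_cast
    ring

/-- The integrand of the Marcum Q-function differs from its value at `a = 0` by `O(a ^ 2)`, with an
explicit constant depending on the integration variable. -/
theorem abs_marcumQ_integrand_sub_le {a x : ℝ} (ha : |a| ≤ 1) (hx : 0 ≤ x) :
    |x * Real.exp (-(x ^ 2 + a ^ 2) / 2) *
        ∑' k : ℕ, ((a * x) ^ 2 / 4) ^ k / (Nat.factorial k : ℝ) ^ 2 -
      x * Real.exp (-x ^ 2 / 2)| ≤
    a ^ 2 * (x ^ 1 * Real.exp (-(1 / 2) * x ^ 2) + x ^ 3 * Real.exp (-(1 / 4) * x ^ 2)) := by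
  set S := ∑' k : ℕ, ((a * x) ^ 2 / 4) ^ k / (Nat.factorial k : ℝ) ^ 2
  have hS1 : 1 ≤ S := one_le_besselI_zero (a * x)
  have hS2 : S ≤ Real.exp ((a * x) ^ 2 / 4) := besselI_zero_le_exp (a * x)
  have ha2 : a ^ 2 ≤ 1 := (sq_le_one_iff_abs_le_one a).2 ha
  have hmono : Real.exp ((a * x) ^ 2 / 4) ≤ Real.exp (x ^ 2 / 4) := by
    refine Real.exp_le_exp.2 ?_
    nlinarith [mul_le_mul_of_nonneg_right ha2 (sq_nonneg x)]
  have hS3 : S - 1 ≤ a ^ 2 * (x ^ 2 * Real.exp (x ^ 2 / 4)) := by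
    have h1 := exp_sub_one_le_mul_exp ((a * x) ^ 2 / 4)
    have h2 : (a * x) ^ 2 / 4 * Real.exp ((a * x) ^ 2 / 4) ≤
        (a * x) ^ 2 * Real.exp (x ^ 2 / 4) := by
      gcongr
      nlinarith [sq_nonneg (a * x)]
    linarith
  have he1 : Real.exp (-a ^ 2 / 2) ≤ 1 := Real.exp_le_one_iff.2 (by nlinarith [sq_nonneg a])
  have he2 : 1 - a ^ 2 ≤ Real.exp (-a ^ 2 / 2) := by
    nlinarith [Real.add_one_le_exp (-a ^ 2 / 2), sq_nonneg a]
  have hkey : |Real.exp (-a ^ 2 / 2) * S - 1| ≤ a ^ 2 * (1 + x ^ 2 * Real.exp (x ^ 2 / 4)) := by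
    have hnonneg : 0 ≤ a ^ 2 * (x ^ 2 * Real.exp (x ^ 2 / 4)) := by positivity
    have hpos := Real.exp_pos (-a ^ 2 / 2)
    rw [abs_le]
    constructor <;> nlinarith [sq_nonneg a]
  have hsplit : Real.exp (-(x ^ 2 + a ^ 2) / 2) =
      Real.exp (-x ^ 2 / 2) * Real.exp (-a ^ 2 / 2) := by
    rw [← Real.exp_add]
    ring_nf
  have hquarter : Real.exp (-(1 / 4) * x ^ 2) = Real.exp (-x ^ 2 / 2) * Real.exp (x ^ 2 / 4) := by
    rw [← Real.exp_add]
    ring_nf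
  have hhalf : Real.exp (-(1 / 2) * x ^ 2) = Real.exp (-x ^ 2 / 2) := by ring_nf
  calc _ = |x * Real.exp (-x ^ 2 / 2) * (Real.exp (-a ^ 2 / 2) * S - 1)| := by
        rw [hsplit]
        ring_nf
    _ = x * Real.exp (-x ^ 2 / 2) * |Real.exp (-a ^ 2 / 2) * S - 1| := by
        rw [abs_mul, abs_of_nonneg (by positivity)]
    _ ≤ x * Real.exp (-x ^ 2 / 2) * (a ^ 2 * (1 + x ^ 2 * Real.exp (x ^ 2 / 4))) := by gcongr
    _ = _ := by
        rw [hquarter, hhalf]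
        ring

/-- The Marcum Q-function is `exp (-b ^ 2 / 2) + O(a ^ 2)`, uniformly in `b ≥ 0`. -/
theorem exists_abs_marcumQ_sub_exp_le :
    ∃ C : ℝ, ∀ a b : ℝ, |a| ≤ 1 → 0 ≤ b →
      |(∫ x in Set.Ici b, x * Real.exp (-(x ^ 2 + a ^ 2) / 2) *
          ∑' k : ℕ, ((a * x) ^ 2 / 4) ^ k / (Nat.factorial k : ℝ) ^ 2) -
        Real.exp (-b ^ 2 / 2)| ≤ C * a ^ 2 := by
  set g : ℝ → ℝ := fun x =>
    x ^ 1 * Real.exp (-(1 / 2) * x ^ 2) + x ^ 3 * Real.exp (-(1 / 4) * x ^ 2) with hg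
  have hgi : MeasureTheory.Integrable g :=
    (integrable_pow_mul_exp_neg_mul_sq 1 (by norm_num)).add
      (integrable_pow_mul_exp_neg_mul_sq 3 (by norm_num))
  refine ⟨∫ x in Set.Ici 0, g x, fun a b ha hb => ?_⟩
  set f : ℝ → ℝ := fun x => x * Real.exp (-(x ^ 2 + a ^ 2) / 2) *
    ∑' k : ℕ, ((a * x) ^ 2 / 4) ^ k / (Nat.factorial k : ℝ) ^ 2
  set f₀ : ℝ → ℝ := fun x => x * Real.exp (-x ^ 2 / 2) with hf₀
  have hfm : Measurable f :=
    Measurable.mul (by fun_prop) (measurable_besselI_zero.comp (measurable_const_mul a))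
  have hf₀i : MeasureTheory.Integrable f₀ := by
    refine (integrable_pow_mul_exp_neg_mul_sq 1 (c := 1 / 2) (by norm_num)).congr
      (.of_forall fun x => ?_)
    simp only [hf₀]
    ring_nf
  have hle : ∀ x ∈ Set.Ici b, ‖f x - f₀ x‖ ≤ a ^ 2 * g x := fun x hx =>
    abs_marcumQ_integrand_sub_le ha (hb.trans hx)
  have hae : ∀ᵐ x ∂MeasureTheory.volume.restrict (Set.Ici b), ‖f x - f₀ x‖ ≤ a ^ 2 * g x :=
    MeasureTheory.ae_restrict_of_forall_mem measurableSet_Ici hle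
  have hdi : MeasureTheory.IntegrableOn (fun x => f x - f₀ x) (Set.Ici b) :=
    MeasureTheory.Integrable.mono' (hgi.const_mul (a ^ 2)).integrableOn
      (hfm.sub (by fun_prop)).aestronglyMeasurable hae
  have hfi : MeasureTheory.IntegrableOn f (Set.Ici b) := by
    refine (hdi.add hf₀i.integrableOn).congr_fun (fun x _ => ?_) measurableSet_Ici
    simp
  rw [← integral_Ici_mul_exp_neg_sq_div_two, ← MeasureTheory.integral_sub hfi hf₀i.integrableOn,
    ← Real.norm_eq_abs, mul_comm]
  refine (MeasureTheory.norm_integral_le_of_norm_le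
    (hgi.const_mul (a ^ 2)).integrableOn hae).trans ?_
  rw [MeasureTheory.integral_const_mul]
  gcongr ?_ * ?_
  refine MeasureTheory.setIntegral_mono_set hgi.integrableOn ?_
    (Set.Ici_subset_Ici.2 hb).eventuallyLE
  refine MeasureTheory.ae_restrict_of_forall_mem measurableSet_Ici fun x (hx : 0 ≤ x) => ?_
  simp only [hg, Pi.zero_apply]
  positivity

/-- the difference between the large-N ROC expression for ρ̂ and
its first-order-in-ρ approximation is O(ρ²) as ρ → 0 within (−1, 1). -/
theorem roc_rho_hat_first_order
    (I₀ : ℝ → ℝ)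
    (hI₀ : ∀ x : ℝ, I₀ x = ∑' k : ℕ, (x ^ 2 / 4) ^ k / (Nat.factorial k : ℝ) ^ 2)
    (Q₁ : ℝ → ℝ → ℝ)
    (hQ₁ : ∀ a b : ℝ, Q₁ a b =
      ∫ x in Set.Ici b, x * Real.exp (-(x ^ 2 + a ^ 2) / 2) * I₀ (a * x))
    (N : ℝ) (hN : 0 < N) (b : ℝ) (hb : 0 < b) :
    (fun ρ : ℝ =>
        Q₁ (ρ * Real.sqrt (2 * N) / (1 - ρ ^ 2)) (b / (1 - ρ ^ 2)) -
          Q₁ (ρ * Real.sqrt (2 * N)) b) =O[nhdsWithin 0 (Set.Ioo (-1) 1)]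
      fun ρ : ℝ => ρ ^ 2 := by
  refine IsBigO.mono ?_ nhdsWithin_le_nhds
  obtain ⟨C, hC⟩ := exists_abs_marcumQ_sub_exp_le
  simp only [← hI₀, ← hQ₁] at hC
  have hQ : ∀ u v : ℝ → ℝ, DifferentiableAt ℝ u 0 → u 0 = 0 → (∀ᶠ ρ in nhds 0, 0 ≤ v ρ) →
      (fun ρ => Q₁ (u ρ) (v ρ) - Real.exp (-v ρ ^ 2 / 2)) =O[nhds 0] fun ρ : ℝ => ρ ^ 2 := by
    intro u v hu hu0 hv
    have hsmall : ∀ᶠ ρ in nhds 0, |u ρ| < 1 :=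
      hu.continuousAt.abs.eventually_lt continuousAt_const (by simp [hu0])
    have hO : u =O[nhds 0] fun ρ : ℝ => ρ := by simpa [hu0] using hu.isBigO_sub
    refine IsBigO.trans (IsBigO.of_bound C ?_) (hO.pow 2)
    filter_upwards [hsmall, hv] with ρ h1 h2
    simpa using hC _ _ h1.le h2
  have hpos : ∀ᶠ ρ : ℝ in nhds 0, 0 ≤ b / (1 - ρ ^ 2) := by
    have hcont : ContinuousAt (fun ρ : ℝ => 1 - ρ ^ 2) 0 := by fun_prop
    filter_upwards [continuousAt_const.eventually_lt hcont (by norm_num : (0 : ℝ) < 1 - 0 ^ 2)]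
      with ρ h
    positivity
  have hfull := hQ (fun ρ => ρ * Real.sqrt (2 * N) / (1 - ρ ^ 2)) (fun ρ => b / (1 - ρ ^ 2))
    (by fun_prop (disch := norm_num)) (by simp) hpos
  have happrox := hQ (fun ρ => ρ * Real.sqrt (2 * N)) (fun _ => b) (by fun_prop) (by simp)
    (.of_forall fun _ => hb.le)
  have hexp : (fun ρ : ℝ => Real.exp (-(b / (1 - ρ ^ 2)) ^ 2 / 2) - Real.exp (-b ^ 2 / 2))
      =O[nhds 0] fun ρ : ℝ => ρ ^ 2 := by
    have hd : DifferentiableAt ℝ (fun t : ℝ => Real.exp (-(b / (1 - t)) ^ 2 / 2)) 0 := by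
      fun_prop (disch := norm_num)
    have hsq : Tendsto (fun ρ : ℝ => ρ ^ 2) (nhds 0) (nhds 0) := by
      simpa using (continuous_pow 2).tendsto (0 : ℝ)
    simpa [Function.comp_def] using hd.isBigO_sub.comp_tendsto hsq
  refine ((hfull.sub happrox).add hexp).congr_left fun ρ => ?_
  ring
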